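/- arXiv:2011.06569 — 2 statements merged into one kernel-verified Lean document; each statement's English description precedes it below -/
import Mathlib

section
/- Fix d ≥ 1, a nonempty index type X, and families (ρ_x)_{x∈X}, (σ_x)_{x∈X} of positive definite density matrices on ℂ^d such that D_sup := sup_{x∈X} D(ρ_x‖σ_x) and D̄_sup := sup_{x∈X} D(σ_x‖ρ_x) are both finite. Then the Hoeffding function B(r) := sup_{x∈X} sup_{α∈(0,1)} ((α−1)/α)·(r − D_α(ρ_x‖σ_x)) is a real-valued convex function of r on [0,∞), and it is continuous at every r₀ ≥ 0 (in particular, right-continuous at r₀ = 0). -/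
open Matrix ComplexOrder

/-- Functional calculus for a matrix: apply `f` to the eigenvalues of a Hermitian matrix
(junk value `0` on non-Hermitian input). -/
noncomputable def matFun {n : Type*} [Fintype n] [DecidableEq n] (f : ℝ → ℝ)
    (A : Matrix n n ℂ) : Matrix n n ℂ :=
  if hA : A.IsHermitian then
    (hA.eigenvectorUnitary : Matrix n n ℂ) *
      Matrix.diagonal (fun i => (f (hA.eigenvalues i) : ℂ)) *
      (hA.eigenvectorUnitary : Matrix n n ℂ)ᴴ
  else 0

/-- Real matrix power `A^t` via functional calculus (with `0^t = 0`). -/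
noncomputable def mrpow {n : Type*} [Fintype n] [DecidableEq n]
    (A : Matrix n n ℂ) (t : ℝ) : Matrix n n ℂ :=
  matFun (fun x => x ^ t) A

/-- Matrix logarithm via functional calculus. -/
noncomputable def mlog {n : Type*} [Fintype n] [DecidableEq n]
    (A : Matrix n n ℂ) : Matrix n n ℂ :=
  matFun Real.log A

/-- The quantum Rényi relative entropy `D_α(ρ‖σ) = (1/(α−1))·log Tr(ρ^α σ^{1−α})`. -/
noncomputable def renyiD {n : Type*} [Fintype n] [DecidableEq n]
    (α : ℝ) (ρ σ : Matrix n n ℂ) : ℝ :=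
  (1 / (α - 1)) * Real.log ((mrpow ρ α * mrpow σ (1 - α)).trace.re)

/-- The quantum relative entropy `D(ρ‖σ) = Tr[ρ(log ρ − log σ)]`. -/
noncomputable def qRelEnt {n : Type*} [Fintype n] [DecidableEq n]
    (ρ σ : Matrix n n ℂ) : ℝ :=
  ((ρ * (mlog ρ - mlog σ)).trace).re

theorem matFun_eq {n : Type*} [Fintype n] [DecidableEq n] (f : ℝ → ℝ)
    {A : Matrix n n ℂ} (hA : A.IsHermitian) : matFun f A =
    (hA.eigenvectorUnitary : Matrix n n ℂ) *
      Matrix.diagonal (fun i => (f (hA.eigenvalues i) : ℂ)) *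
      (hA.eigenvectorUnitary : Matrix n n ℂ)ᴴ := by
  simp [matFun, hA]

theorem matFun_mul {n : Type*} [Fintype n] [DecidableEq n] (f g : ℝ → ℝ)
    {A : Matrix n n ℂ} (hA : A.IsHermitian) :
    matFun f A * matFun g A = matFun (fun x => f x * g x) A := by
  rw [matFun_eq f hA, matFun_eq g hA, matFun_eq _ hA]
  have h : (hA.eigenvectorUnitary : Matrix n n ℂ)ᴴ * (hA.eigenvectorUnitary : Matrix n n ℂ) = 1 :=
    Unitary.coe_star_mul_self hA.eigenvectorUnitary
  have h2 : ∀ U D E V : Matrix n n ℂ, V * U = 1 →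
      U * D * V * (U * E * V) = U * (D * E) * V := by
    intro U D E V hh
    calc U * D * V * (U * E * V) = U * D * (V * U) * E * V := by simp only [Matrix.mul_assoc]
      _ = _ := by rw [hh]; simp only [Matrix.mul_assoc, Matrix.mul_one]
  rw [h2 _ _ _ _ h, Matrix.diagonal_mul_diagonal]
  simp

theorem matFun_one {n : Type*} [Fintype n] [DecidableEq n]
    {A : Matrix n n ℂ} (hA : A.IsHermitian) :
    matFun (fun _ => 1) A = 1 := by
  rw [matFun_eq _ hA]
  have h : (hA.eigenvectorUnitary : Matrix n n ℂ) * (hA.eigenvectorUnitary : Matrix n n ℂ)ᴴ = 1 :=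
    Unitary.coe_mul_star_self hA.eigenvectorUnitary
  simp [h]

theorem matFun_id {n : Type*} [Fintype n] [DecidableEq n]
    {A : Matrix n n ℂ} (hA : A.IsHermitian) :
    matFun (fun x => x) A = A := by
  rw [matFun_eq _ hA]
  conv_rhs => rw [hA.spectral_theorem]
  rfl

theorem trace_matFun {n : Type*} [Fintype n] [DecidableEq n]
    {A C : Matrix n n ℂ} (hA : A.IsHermitian) (hC : C.IsHermitian) :
    ∃ w : n × n → ℝ, (∀ p, 0 ≤ w p) ∧ ∀ f g : ℝ → ℝ,
      (matFun f A * matFun g C).trace.re =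
        ∑ p, w p * (f (hA.eigenvalues p.1) * g (hC.eigenvalues p.2)) := by
  set U := (hA.eigenvectorUnitary : Matrix n n ℂ) with hU
  set V := (hC.eigenvectorUnitary : Matrix n n ℂ) with hV
  refine ⟨fun p => Complex.normSq ((Uᴴ * V) p.1 p.2), fun p => Complex.normSq_nonneg _, ?_⟩
  intro f g
  rw [matFun_eq f hA, matFun_eq g hC, ← hU, ← hV]
  set D := Matrix.diagonal (fun i => (f (hA.eigenvalues i) : ℂ))
  set E := Matrix.diagonal (fun i => (g (hC.eigenvalues i) : ℂ))
  have h1 : (U * D * Uᴴ * (V * E * Vᴴ)).trace = (D * (Uᴴ * V) * (E * (Uᴴ * V)ᴴ)).trace := by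
    rw [Matrix.conjTranspose_mul, Matrix.conjTranspose_conjTranspose]
    calc (U * D * Uᴴ * (V * E * Vᴴ)).trace = (U * (D * Uᴴ * (V * E * Vᴴ))).trace := by
          simp only [Matrix.mul_assoc]
      _ = _ := by rw [Matrix.trace_mul_comm]; simp only [Matrix.mul_assoc]
  rw [h1, Fintype.sum_prod_type]
  simp only [Matrix.trace, Matrix.diag]
  rw [Complex.re_sum]
  refine Finset.sum_congr rfl fun i _ => ?_
  rw [Matrix.mul_apply, Complex.re_sum]
  refine Finset.sum_congr rfl fun j _ => ?_
  rw [Matrix.diagonal_mul, Matrix.diagonal_mul, Matrix.conjTranspose_apply]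
  have : ∀ (a b : ℝ) (z : ℂ), ((a : ℂ) * z * ((b : ℂ) * star z)).re
      = Complex.normSq z * (a * b) := by
    intro a b z
    have : (a : ℂ) * z * ((b : ℂ) * star z) = ((Complex.normSq z * (a * b) : ℝ) : ℂ) := by
      push_cast
      rw [← Complex.mul_conj]
      simp only [RCLike.star_def]
      ring
    rw [this, Complex.ofReal_re]
  exact this _ _ _

theorem log_trace_ge {n : Type*} [Fintype n] [DecidableEq n]
    {A C : Matrix n n ℂ} (hA : A.PosDef) (hC : C.PosDef) (hC1 : C.trace = 1) (α : ℝ) :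
    - (α * qRelEnt C A) ≤ Real.log ((mrpow A α * mrpow C (1 - α)).trace.re) := by
  have hAH := hA.isHermitian
  have hCH := hC.isHermitian
  obtain ⟨w, hw, h⟩ := trace_matFun hAH hCH
  have la : ∀ i, 0 < hAH.eigenvalues i := hA.eigenvalues_pos
  have lc : ∀ i, 0 < hCH.eigenvalues i := hC.eigenvalues_pos
  set a := hAH.eigenvalues
  set c := hCH.eigenvalues
  have hsum : ∑ p, w p * c p.2 = 1 := by
    have := h (fun _ => 1) (fun x => x)
    rw [matFun_one hAH, matFun_id hCH, Matrix.one_mul, hC1] at this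
    simpa using this.symm
  have hrel : qRelEnt C A = ∑ p, w p * c p.2 * (Real.log (c p.2) - Real.log (a p.1)) := by
    unfold qRelEnt mlog
    rw [Matrix.mul_sub, Matrix.trace_sub, Complex.sub_re]
    have e1 : C * matFun Real.log C = matFun (fun _ => 1) A * matFun (fun x => x * Real.log x) C := by
      rw [matFun_one hAH, Matrix.one_mul, ← matFun_mul (fun x => x) Real.log hCH, matFun_id hCH]
    have e2 : (C * matFun Real.log A).trace = (matFun Real.log A * matFun (fun x => x) C).trace := by
      rw [matFun_id hCH, Matrix.trace_mul_comm]
    rw [e1, e2, h, h, ← Finset.sum_sub_distrib]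
    exact Finset.sum_congr rfl fun p _ => by ring
  have hT : (mrpow A α * mrpow C (1 - α)).trace.re =
      ∑ p, w p * c p.2 * (a p.1 / c p.2) ^ α := by
    unfold mrpow
    rw [h]
    refine Finset.sum_congr rfl fun p _ => ?_
    rw [Real.div_rpow (la _).le (lc _).le, Real.rpow_sub (lc _), Real.rpow_one]
    ring
  rw [hT, hrel]
  have J := strictConcaveOn_log_Ioi.concaveOn.le_map_sum (t := Finset.univ)
    (w := fun p => w p * c p.2) (p := fun p : n × n => (a p.1 / c p.2) ^ α)
    (fun p _ => mul_nonneg (hw p) (lc _).le) hsum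
    (fun p _ => Real.rpow_pos_of_pos (div_pos (la _) (lc _)) _)
  simp only [smul_eq_mul] at J
  refine le_trans (le_of_eq ?_) J
  rw [Finset.mul_sum, ← Finset.sum_neg_distrib]
  refine Finset.sum_congr rfl fun p _ => ?_
  rw [Real.log_rpow (div_pos (la _) (lc _)), Real.log_div (la _).ne' (lc _).ne']
  ring

theorem sup_affine {ι : Type*} [Nonempty ι] (a b : ι → ℝ) (ha : ∀ i, a i ≤ 0) (C : ℝ)
    (hb : ∀ i, b i ≤ C) (B : ℝ → ℝ) (hB : ∀ r, 0 ≤ r → IsLUB (Set.range fun i => a i * r + b i) (B r)) :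
    ConvexOn ℝ (Set.Ici (0 : ℝ)) B ∧
    ∀ r₀ : ℝ, 0 ≤ r₀ → ContinuousWithinAt B (Set.Ici (0 : ℝ)) r₀ := by
  have hconv : ConvexOn ℝ (Set.Ici (0 : ℝ)) B := by
    refine ⟨convex_Ici 0, ?_⟩
    intro x hx y hy s t hs ht hst
    simp only [smul_eq_mul]
    have hx' : 0 ≤ x := hx
    have hy' : 0 ≤ y := hy
    refine (hB _ (by positivity)).2 ?_
    rintro _ ⟨i, rfl⟩
    have h1 : a i * x + b i ≤ B x := (hB x hx').1 ⟨i, rfl⟩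
    have h2 : a i * y + b i ≤ B y := (hB y hy').1 ⟨i, rfl⟩
    have h3 := mul_le_mul_of_nonneg_left h1 hs
    have h4 := mul_le_mul_of_nonneg_left h2 ht
    have h5 : b i = s * b i + t * b i := by rw [← add_mul, hst, one_mul]
    dsimp only
    nlinarith
  refine ⟨hconv, ?_⟩
  intro r₀ hr₀
  rcases hr₀.eq_or_lt with h0 | h0
  · subst h0
    have hanti : ∀ r, 0 ≤ r → B r ≤ B 0 := by
      intro r hr
      refine (hB r hr).2 ?_
      rintro _ ⟨i, rfl⟩
      have h2 : a i * 0 + b i ≤ B 0 := (hB 0 le_rfl).1 ⟨i, rfl⟩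
      have := mul_nonpos_of_nonpos_of_nonneg (ha i) hr
      dsimp only
      linarith
    refine tendsto_order.2 ⟨?_, ?_⟩
    · intro u hu
      obtain ⟨_, ⟨i, rfl⟩, hi, -⟩ := (hB 0 le_rfl).exists_between hu
      have hc : Filter.Tendsto (fun r => a i * r + b i) (nhdsWithin 0 (Set.Ici 0))
          (nhds (a i * 0 + b i)) :=
        (Continuous.tendsto (by fun_prop) 0).mono_left nhdsWithin_le_nhds
      filter_upwards [hc.eventually_const_lt hi, self_mem_nhdsWithin] with r h1 h2
      exact h1.trans_le ((hB r h2).1 ⟨i, rfl⟩)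
    · intro u hu
      filter_upwards [self_mem_nhdsWithin] with r h2
      exact (hanti r h2).trans_lt hu
  · have := hconv.continuousOn_interior
    rw [interior_Ici] at this
    exact (this.continuousAt (Ioi_mem_nhds h0)).continuousWithinAt

open Classical in
theorem biSup_real_eq (f : ℝ → ℝ) (α : ℝ) :
    (⨆ (_ : α ∈ Set.Ioo (0 : ℝ) 1), f α) = if α ∈ Set.Ioo (0 : ℝ) 1 then f α else 0 := by
  by_cases h : α ∈ Set.Ioo (0 : ℝ) 1
  · rw [if_pos h, ciSup_pos h]
  · rw [if_neg h]
    haveI : IsEmpty (α ∈ Set.Ioo (0 : ℝ) 1) := ⟨h⟩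
    exact Real.iSup_of_isEmpty _

/-- the Hoeffding function
`B(r) = sup_x sup_{α∈(0,1)} ((α−1)/α)(r − D_α(ρ_x‖σ_x))` of a pair of cq-channels with
finite `sup_x D(ρ_x‖σ_x)` and `sup_x D(σ_x‖ρ_x)` is convex on `[0,∞)` and continuous at
every `r₀ ≥ 0` (within `[0,∞)`). -/
theorem hoeffding_function_convex_continuous
    (d : ℕ) (hd : 1 ≤ d) {X : Type*} [Nonempty X]
    (ρ σ : X → Matrix (Fin d) (Fin d) ℂ)
    (hρ : ∀ x, (ρ x).PosDef ∧ (ρ x).trace = 1)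
    (hσ : ∀ x, (σ x).PosDef ∧ (σ x).trace = 1)
    (hDfin : BddAbove (Set.range fun x => qRelEnt (ρ x) (σ x)))
    (hDbfin : BddAbove (Set.range fun x => qRelEnt (σ x) (ρ x)))
    (B : ℝ → ℝ)
    (hB : ∀ r, B r = ⨆ x : X, ⨆ α ∈ Set.Ioo (0 : ℝ) 1,
      ((α - 1) / α) * (r - renyiD α (ρ x) (σ x))) :
    ConvexOn ℝ (Set.Ici (0 : ℝ)) B ∧
    ∀ r₀ : ℝ, 0 ≤ r₀ → ContinuousWithinAt B (Set.Ici (0 : ℝ)) r₀ := by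
  classical
  obtain ⟨K, hK⟩ := hDbfin
  let a : X × ℝ → ℝ := fun p => if p.2 ∈ Set.Ioo (0 : ℝ) 1 then (p.2 - 1) / p.2 else 0
  let b : X × ℝ → ℝ := fun p => if p.2 ∈ Set.Ioo (0 : ℝ) 1 then
    ((p.2 - 1) / p.2) * (- renyiD p.2 (ρ p.1) (σ p.1)) else 0
  have ha : ∀ p, a p ≤ 0 := by
    intro p
    dsimp only [a]
    split_ifs with h
    · exact div_nonpos_of_nonpos_of_nonneg (by linarith [h.2]) h.1.le
    · exact le_rfl
  have hb : ∀ p, b p ≤ max K 0 := by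
    intro p
    dsimp only [b]
    split_ifs with h
    · refine le_trans ?_ (le_max_left _ _)
      have hk : qRelEnt (σ p.1) (ρ p.1) ≤ K := hK ⟨p.1, rfl⟩
      refine le_trans ?_ hk
      have hl := log_trace_ge (hρ p.1).1 (hσ p.1).1 (hσ p.1).2 p.2
      unfold renyiD
      have h1 : p.2 - 1 ≠ 0 := by linarith [h.2]
      have h0 := h.1
      set L := Real.log ((mrpow (ρ p.1) p.2 * mrpow (σ p.1) (1 - p.2)).trace.re)
      have : (p.2 - 1) / p.2 * -(1 / (p.2 - 1) * L) = (-L) / p.2 := by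
        field_simp
      rw [this, div_le_iff₀ h0]
      linarith
    · exact le_max_right _ _
  refine sup_affine a b ha (max K 0) hb B ?_
  intro r hr
  have hform : ∀ x α, (⨆ (_ : α ∈ Set.Ioo (0 : ℝ) 1),
      ((α - 1) / α) * (r - renyiD α (ρ x) (σ x))) = a (x, α) * r + b (x, α) := by
    intro x α
    rw [biSup_real_eq (fun α => ((α - 1) / α) * (r - renyiD α (ρ x) (σ x)))]
    dsimp only [a, b]
    split_ifs
    · ring
    · ring
  have hle : ∀ p, a p * r + b p ≤ max K 0 := fun p => by
    have := mul_nonpos_of_nonpos_of_nonneg (ha p) hr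
    linarith [hb p]
  rw [hB r]
  simp only [hform]
  have hbd1 : ∀ x, BddAbove (Set.range fun α => a (x, α) * r + b (x, α)) := fun x =>
    ⟨max K 0, by rintro _ ⟨α, rfl⟩; exact hle _⟩
  have hbd2 : BddAbove (Set.range fun x => ⨆ α, a (x, α) * r + b (x, α)) :=
    ⟨max K 0, by rintro _ ⟨x, rfl⟩; exact ciSup_le fun α => hle _⟩
  constructor
  · rintro _ ⟨⟨x, α⟩, rfl⟩
    exact (le_ciSup (hbd1 x) α).trans (le_ciSup hbd2 x)
  · intro u hu
    exact ciSup_le fun x => ciSup_le fun α => hu ⟨(x, α), rfl⟩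
end

section
/- Let M be a quantum channel from ℂ^d to ℂ^{d'} given by a finite Kraus family (K_l) with Σ_l K_l†K_l = I, and suppose that M(ψψ†) is positive definite for every unit vector ψ ∈ ℂ^d. Then for every fixed α ∈ (0,1), the supremum of D_α(M(ρ)‖M(σ)) over all pairs (ρ,σ) of density matrices on ℂ^d equals the supremum of D_α(M(ψψ†)‖M(φφ†)) over all pairs (ψ,φ) of unit vectors in ℂ^d; that is, pure input states suffice for maximizing the Rényi relative entropy of the channel outputs. -/
open Matrix ComplexOrder

/-- A density matrix: positive semidefinite with unit trace. -/
def IsDensity {n : Type*} [Fintype n] (ρ : Matrix n n ℂ) : Prop :=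
  ρ.PosSemidef ∧ ρ.trace = 1

section helpers

open scoped MatrixOrder Matrix.Norms.L2Operator

lemma mrpow_eq_rpow {n : Type*} [Fintype n] [DecidableEq n] {A : Matrix n n ℂ}
    (hA : A.PosSemidef) (t : ℝ) (ht : 0 ≤ t) : mrpow A t = A ^ t := by
  rw [CFC.rpow_eq_cfc_real hA.nonneg, hA.1.cfc_eq]
  simp only [mrpow, matFun, dif_pos hA.1, Matrix.IsHermitian.cfc, Unitary.conjStarAlgAut_apply]
  rfl

lemma trace_mul_re_nonneg {n : Type*} [Fintype n] [DecidableEq n] {A B : Matrix n n ℂ}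
    (hA : A.PosSemidef) (hB : B.PosSemidef) : 0 ≤ ((A * B).trace).re := by
  obtain ⟨C, rfl⟩ := CStarAlgebra.nonneg_iff_eq_star_mul_self.mp hB.nonneg
  have h := (hA.mul_mul_conjTranspose_same C).trace_nonneg
  rw [← mul_assoc, Matrix.trace_mul_comm, ← mul_assoc]
  exact (Complex.le_def.mp h).1

lemma trace_mul_re_pos {n : Type*} [Fintype n] [DecidableEq n] [Nonempty n] {A B : Matrix n n ℂ}
    (hA : A.PosDef) (hB : B.PosDef) : 0 < ((A * B).trace).re := by
  obtain ⟨C, hC⟩ := CStarAlgebra.nonneg_iff_eq_star_mul_self.mp hB.posSemidef.nonneg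
  have hu : IsUnit C := by
    have := hB.isUnit
    rw [hC] at this
    exact isUnit_of_mul_isUnit_right this
  subst hC
  have hP : (C * A * Cᴴ).PosDef := by
    exact hA.mul_mul_conjTranspose_same (Matrix.vecMul_injective_of_isUnit hu)
  have h := hP.trace_pos
  rw [← mul_assoc, Matrix.trace_mul_comm, ← mul_assoc]
  exact (Complex.lt_def.mp h).1

lemma mrpow_posSemidef {n : Type*} [Fintype n] [DecidableEq n] {A : Matrix n n ℂ}
    (hA : A.PosSemidef) (t : ℝ) (ht : 0 ≤ t) : (mrpow A t).PosSemidef := by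
  rw [mrpow_eq_rpow hA t ht]
  exact Matrix.nonneg_iff_posSemidef.mp CFC.rpow_nonneg

lemma mrpow_posDef {n : Type*} [Fintype n] [DecidableEq n] {A : Matrix n n ℂ}
    (hA : A.PosDef) (t : ℝ) (ht : 0 ≤ t) : (mrpow A t).PosDef := by
  rw [mrpow_eq_rpow hA.posSemidef t ht]
  have : IsStrictlyPositive A := Matrix.isStrictlyPositive_iff_posDef.mpr hA
  exact Matrix.isStrictlyPositive_iff_posDef.mp (IsStrictlyPositive.rpow A t this)

lemma concave_aux {n : Type*} [Fintype n] [DecidableEq n] (t : ℝ) (ht : t ∈ Set.Icc (0:ℝ) 1)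
    {B : Matrix n n ℂ} (hB : B.PosSemidef) :
    ConcaveOn ℝ {A : Matrix n n ℂ | A.PosSemidef} (fun A => ((mrpow A t * B).trace).re) := by
  have hc := CFC.concaveOn_rpow (A := Matrix n n ℂ) ht
  have hs : Convex ℝ {A : Matrix n n ℂ | A.PosSemidef} := by
    have hset : {A : Matrix n n ℂ | A.PosSemidef} = Set.Ici 0 :=
      Set.ext fun A => (Matrix.nonneg_iff_posSemidef (A := A)).symm
    rw [hset]
    exact hc.1
  refine ⟨hs, fun x hx y hy a b ha hb hab => ?_⟩
  have h := hc.2 (Matrix.PosSemidef.nonneg hx) (Matrix.PosSemidef.nonneg hy) ha hb hab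
  have hxy : (a • x + b • y).PosSemidef := hs hx hy ha hb hab
  dsimp only
  rw [mrpow_eq_rpow hx t ht.1, mrpow_eq_rpow hy t ht.1, mrpow_eq_rpow hxy t ht.1]
  have h2 := trace_mul_re_nonneg (Matrix.le_iff.mp h) hB
  simp only [sub_mul, add_mul, Matrix.smul_mul, Matrix.trace_sub, Matrix.trace_add,
    Matrix.trace_smul, Complex.sub_re, Complex.add_re, Complex.smul_re] at h2
  linarith

lemma spectral_sum {n : Type*} [Fintype n] [DecidableEq n] {A : Matrix n n ℂ}
    (hA : A.IsHermitian) : A = ∑ i, hA.eigenvalues i •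
      Matrix.vecMulVec (hA.eigenvectorBasis i).ofLp (star (hA.eigenvectorBasis i).ofLp) := by
  conv_lhs => rw [hA.spectral_theorem]
  ext i j
  rw [Unitary.conjStarAlgAut_apply, Matrix.mul_apply, Matrix.sum_apply]
  refine Finset.sum_congr rfl fun k _ => ?_
  simp [Matrix.mul_diagonal, Matrix.vecMulVec_apply, Matrix.star_apply]
  ring

lemma pure_min (d d' : ℕ) {L : Type*} [Fintype L]
    (K : L → Matrix (Fin d') (Fin d) ℂ)
    (M : Matrix (Fin d) (Fin d) ℂ → Matrix (Fin d') (Fin d') ℂ)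
    (hM : ∀ ρ, M ρ = ∑ l, K l * ρ * (K l)ᴴ) (t : ℝ) (ht : t ∈ Set.Icc (0:ℝ) 1)
    {B : Matrix (Fin d') (Fin d') ℂ} (hB : B.PosSemidef)
    {ρ : Matrix (Fin d) (Fin d) ℂ} (hρ : IsDensity ρ) :
    ∃ ψ : Fin d → ℂ, (∑ k, ‖ψ k‖ ^ 2 = 1) ∧
      ((mrpow (M (Matrix.vecMulVec ψ (star ψ))) t * B).trace).re ≤
        ((mrpow (M ρ) t * B).trace).re := by
  have hpsd : ∀ σ : Matrix (Fin d) (Fin d) ℂ, σ.PosSemidef → (M σ).PosSemidef := by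
    intro σ hσ
    rw [hM]
    exact Matrix.posSemidef_sum _ fun l _ => hσ.mul_mul_conjTranspose_same (K l)
  have hH := hρ.1.1
  set w := hH.eigenvalues with hw
  let v : Fin d → Fin d → ℂ := fun i => (hH.eigenvectorBasis i).ofLp
  have hw0 : ∀ i, 0 ≤ w i := hρ.1.eigenvalues_nonneg
  have hw1 : ∑ i, w i = 1 := by
    have h := hH.trace_eq_sum_eigenvalues
    rw [hρ.2] at h
    have h' := congrArg Complex.re h
    simpa using h'.symm
  have hv : ∀ i, ∑ k, ‖v i k‖ ^ 2 = 1 := by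
    intro i
    have h := hH.eigenvectorBasis.orthonormal.1 i
    rw [← EuclideanSpace.norm_sq_eq, h, one_pow]
  have hMρ : M ρ = ∑ i, w i • M (Matrix.vecMulVec (v i) (star (v i))) := by
    conv_lhs => rw [spectral_sum hH]
    simp only [hM, Matrix.mul_sum, Matrix.sum_mul, Finset.smul_sum, Matrix.mul_smul,
      Matrix.smul_mul]
    rw [Finset.sum_comm]
  have hJ := (concave_aux t ht hB).le_map_sum (t := Finset.univ) (w := w)
    (p := fun i => M (Matrix.vecMulVec (v i) (star (v i)))) (fun i _ => hw0 i) hw1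
    (fun i _ => hpsd _ (Matrix.posSemidef_vecMulVec_self_star _))
  rw [← hMρ] at hJ
  by_contra! hcon
  have hlt : ∑ i, w i • ((mrpow (M ρ) t * B).trace).re <
      ∑ i, w i • ((mrpow (M (Matrix.vecMulVec (v i) (star (v i)))) t * B).trace).re := by
    have hex : ∃ i, 0 < w i := by
      by_contra! h
      have : ∑ i, w i ≤ 0 := Finset.sum_nonpos fun i _ => h i
      linarith
    obtain ⟨i, hi⟩ := hex
    exact Finset.sum_lt_sum
      (fun j _ => mul_le_mul_of_nonneg_left (hcon _ (hv j)).le (hw0 j))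
      ⟨i, Finset.mem_univ i, mul_lt_mul_of_pos_left (hcon _ (hv i)) hi⟩
  rw [← Finset.sum_smul, hw1, one_smul] at hlt
  exact absurd hJ (not_le.mpr hlt)

lemma sSup_eq_of_cofinal {S T : Set ℝ} (hTS : T ⊆ S) (h : ∀ x ∈ S, ∃ y ∈ T, x ≤ y) :
    sSup S = sSup T := by
  have hub : upperBounds S = upperBounds T := by
    refine Set.Subset.antisymm (upperBounds_mono_set hTS) fun b hb x hx => ?_
    obtain ⟨y, hy, hxy⟩ := h x hx
    exact hxy.trans (hb hy)
  rcases S.eq_empty_or_nonempty with hS | hS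
  · subst hS
    rw [Set.subset_empty_iff.mp hTS]
  · have hT : T.Nonempty := by
      obtain ⟨x, hx⟩ := hS
      obtain ⟨y, hy, _⟩ := h x hx
      exact ⟨y, hy⟩
    by_cases hb : BddAbove S
    · have hb' : BddAbove T := hb.mono hTS
      refine IsLUB.unique (isLUB_csSup hS hb) ?_
      have := isLUB_csSup hT hb'
      rw [IsLUB, hub]
      exact this
    · have hb' : ¬ BddAbove T := by
        intro hb'
        apply hb
        rw [BddAbove, hub]
        exact hb'
      rw [Real.sSup_of_not_bddAbove hb, Real.sSup_of_not_bddAbove hb']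

end helpers

/-- pure input states suffice for maximizing the Rényi relative entropy
`D_α(M(ρ)‖M(σ))` of the outputs of a quantum channel `M` over input states. -/
theorem pure_states_suffice_renyi
    (d d' : ℕ) {L : Type*} [Fintype L]
    (K : L → Matrix (Fin d') (Fin d) ℂ)
    (hK : ∑ l, (K l)ᴴ * K l = 1)
    (M : Matrix (Fin d) (Fin d) ℂ → Matrix (Fin d') (Fin d') ℂ)
    (hM : ∀ ρ, M ρ = ∑ l, K l * ρ * (K l)ᴴ)
    (hpd : ∀ ψ : Fin d → ℂ, (∑ k, ‖ψ k‖ ^ 2 = 1) →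
      (M (Matrix.vecMulVec ψ (star ψ))).PosDef)
    (α : ℝ) (hα : α ∈ Set.Ioo (0 : ℝ) 1) :
    sSup {y : ℝ | ∃ ρ σ : Matrix (Fin d) (Fin d) ℂ,
        IsDensity ρ ∧ IsDensity σ ∧ y = renyiD α (M ρ) (M σ)} =
    sSup {y : ℝ | ∃ ψ φ : Fin d → ℂ,
        (∑ k, ‖ψ k‖ ^ 2 = 1) ∧ (∑ k, ‖φ k‖ ^ 2 = 1) ∧
        y = renyiD α (M (Matrix.vecMulVec ψ (star ψ)))
              (M (Matrix.vecMulVec φ (star φ)))} := by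
  have hpsd : ∀ σ : Matrix (Fin d) (Fin d) ℂ, σ.PosSemidef → (M σ).PosSemidef := by
    intro σ hσ
    rw [hM]
    exact Matrix.posSemidef_sum _ fun l _ => hσ.mul_mul_conjTranspose_same (K l)
  have hpure : ∀ ψ : Fin d → ℂ, (∑ k, ‖ψ k‖ ^ 2 = 1) →
      IsDensity (Matrix.vecMulVec ψ (star ψ)) := by
    intro ψ hψ
    refine ⟨Matrix.posSemidef_vecMulVec_self_star _, ?_⟩
    have : ∀ k, ψ k * star (ψ k) = ((‖ψ k‖ ^ 2 : ℝ) : ℂ) := by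
      intro k
      rw [Complex.star_def, Complex.mul_conj, Complex.normSq_eq_norm_sq]
    simp only [Matrix.trace, Matrix.diag_apply, Matrix.vecMulVec_apply, Pi.star_apply, this]
    rw [← Complex.ofReal_sum, hψ, Complex.ofReal_one]
  obtain ⟨h0, h1⟩ := hα
  apply sSup_eq_of_cofinal
  · rintro y ⟨ψ, φ, hψ, hφ, rfl⟩
    exact ⟨_, _, hpure ψ hψ, hpure φ hφ, rfl⟩
  · rintro y ⟨ρ, σ, hρ, hσ, rfl⟩
    obtain ⟨ψ, hψ, hle1⟩ := pure_min d d' K M hM α ⟨h0.le, h1.le⟩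
      (mrpow_posSemidef (hpsd σ hσ.1) (1 - α) (by linarith)) hρ
    obtain ⟨φ, hφ, hle2⟩ := pure_min d d' K M hM (1 - α) ⟨by linarith, by linarith⟩
      (mrpow_posSemidef (hpd ψ hψ).posSemidef α h0.le) hσ
    refine ⟨_, ⟨ψ, φ, hψ, hφ, rfl⟩, ?_⟩
    rw [Matrix.trace_mul_comm, Matrix.trace_mul_comm (mrpow (M σ) _)] at hle2
    have hne : Nonempty (Fin d') := by
      by_contra hcon
      rw [not_nonempty_iff] at hcon
      have hd : ∃ k, ψ k ≠ 0 := by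
        by_contra! hz
        simp [hz] at hψ
      obtain ⟨k, _⟩ := hd
      have := congrFun (congrFun hK k) k
      simp [Matrix.sum_apply, Matrix.mul_apply] at this
    have hpos := trace_mul_re_pos (mrpow_posDef (hpd ψ hψ) α h0.le)
      (mrpow_posDef (hpd φ hφ) (1 - α) (by linarith))
    unfold renyiD
    refine mul_le_mul_of_nonpos_left (Real.log_le_log hpos (hle2.trans hle1)) ?_
    exact one_div_nonpos.mpr (by linarith)
end
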